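/- Let a ≥ b ≥ 0 be integers with a + b even, let ε := 0 if b is even and ε := 1 if b is odd, and set F_ε(X) := ((1 − X)(X + p)/p) · (X² − (p² − p)X + 1)^{ε}. Then for every real number X with X ≠ p, X ≠ 1, X ≠ −1 and pX ≠ 1: F_p(a,b;X) = F_ε(X) + ((X − 1)(X + p)/(X − p)) · { pX(1 − p)·((pX)^{b} − (pX)^{ε})/(pX − 1) + X²(p − p^{−1}X)·(X^{2b} − X^{2ε})/(X² − 1) + (−p^{b+1}(X − 1) + pX^{b+1} − p^{−1}X^{b+2})·(X^{a+1} − X^{b+1})/(X² − 1) }. -/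

import Mathlib

/-- The symbol `[u,v]` of Hironaka, for integers `u ≥ v ≥ 0`. -/
noncomputable def bsym (p u v : ℕ) : ℚ :=
  (∏ i ∈ Finset.Icc 1 u, (1 - (-(p : ℚ))⁻¹ ^ i)) /
    ((∏ i ∈ Finset.Icc 1 v, (1 - (-(p : ℚ))⁻¹ ^ i)) *
      (∏ i ∈ Finset.Icc 1 (u - v), (1 - (-(p : ℚ))⁻¹ ^ i)))

/-- For a pair `a = (a₁, a₂)`, the quantity `a'_i = #{j ∈ {1,2} : a_j ≥ i}`. -/
def dualCt (a : ℕ × ℕ) (i : ℕ) : ℕ :=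
  (if i ≤ a.1 then 1 else 0) + (if i ≤ a.2 then 1 else 0)

/-- Hironaka's local factor `I_j(μ, λ)`, for pairs `μ = (c,d)`, `λ = (λ₁,λ₂)`. -/
noncomputable def hirI (p : ℕ) (μ lam : ℕ × ℕ) (j : ℕ) : ℚ :=
  ∑ i ∈ Finset.Icc (dualCt μ (j + 1))
      (min (dualCt (lam.1 + 1, lam.2 + 1) (j + 1)) (dualCt μ j)),
    (-(p : ℚ)) ^ (i * (2 * dualCt (lam.1 + 1, lam.2 + 1) (j + 1) + 1 - i) / 2) *
      bsym p (dualCt (lam.1 + 1, lam.2 + 1) (j + 1) - dualCt μ (j + 1))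
        (dualCt (lam.1 + 1, lam.2 + 1) (j + 1) - i) *
      bsym p (dualCt (lam.1 + 1, lam.2 + 1) j - i)
        (dualCt (lam.1 + 1, lam.2 + 1) j - dualCt μ j)

/-- `ε_n = 0` if `n = 0` and `1` otherwise. -/
def epsn (n : ℕ) : ℕ := if n = 0 then 0 else 1

/-- The specialization `F_p(a,b;X)` of Hironaka's formula for Hermitian representation
densities: `α(diag(p,1) ⊕ 1_r, diag(p^a, p^b)) = F_p(a,b;(-p)^{-r})`. -/
noncomputable def Fp (p a b : ℕ) (X : ℝ) : ℝ :=
  ∑ c ∈ Finset.range (a + 2), ∑ d ∈ Finset.range (min c (b + 1) + 1),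
    (-1 : ℝ) ^ d * ((p : ℝ) ^ (2 * d + c))⁻¹ * X ^ (c + d) *
      (-(p : ℝ)) ^ (epsn c + epsn d) *
      ∏ j ∈ Finset.Icc 1 (a + 1), ((hirI p (c, d) (a, b) j : ℚ) : ℝ)

/-- The local factor `I_j(μ, λ)` as a function of the four column lengths it depends on, namely
those of columns `j` and `j + 1` of the shifted pair and of `μ`. -/
noncomputable def localFactor (p L L' m m' : ℕ) : ℚ :=
  ∑ i ∈ Finset.Icc m' (min L' m),
    (-(p : ℚ)) ^ (i * (2 * L' + 1 - i) / 2) * bsym p (L' - m') (L' - i) * bsym p (L - i) (L - m)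

theorem hirI_eq_localFactor (p : ℕ) (μ lam : ℕ × ℕ) (j : ℕ) :
    hirI p μ lam j = localFactor p (dualCt (lam.1 + 1, lam.2 + 1) j)
      (dualCt (lam.1 + 1, lam.2 + 1) (j + 1)) (dualCt μ j) (dualCt μ (j + 1)) := rfl

theorem one_sub_neg_inv_pow_ne_zero {p i : ℕ} (hp : 1 < p) (hi : 1 ≤ i) :
    (1 : ℚ) - (-(p : ℚ))⁻¹ ^ i ≠ 0 := by
  have h1 : |(-(p : ℚ))⁻¹| < 1 := by
    rw [abs_inv, abs_neg, Nat.abs_cast]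
    exact inv_lt_one_of_one_lt₀ (by exact_mod_cast hp)
  have h2 : |(-(p : ℚ))⁻¹ ^ i| < 1 := by
    rw [abs_pow]
    exact pow_lt_one₀ (abs_nonneg _) h1 (by omega)
  linarith [(abs_lt.1 h2).2]

theorem bsym_zero_right {p : ℕ} (hp : 1 < p) (u : ℕ) : bsym p u 0 = 1 := by
  have h : ∏ i ∈ Finset.Icc 1 u, (1 - (-(p : ℚ))⁻¹ ^ i) ≠ 0 :=
    Finset.prod_ne_zero_iff.2 fun i hi ↦
      one_sub_neg_inv_pow_ne_zero hp (Finset.mem_Icc.1 hi).1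
  simp only [bsym, Nat.sub_zero, zero_lt_one, Finset.Icc_eq_empty_of_lt, Finset.prod_empty,
    one_mul]
  exact div_self h

theorem bsym_self {p : ℕ} (hp : 1 < p) (u : ℕ) : bsym p u u = 1 := by
  rw [← bsym_zero_right hp u, bsym, bsym, Nat.sub_self, Nat.sub_zero, mul_comm]

theorem bsym_two_one {p : ℕ} (hp : 1 < p) : bsym p 2 1 = 1 + (-(p : ℚ))⁻¹ := by
  have h1 : (1 : ℚ) - (-(p : ℚ))⁻¹ ≠ 0 := by simpa using one_sub_neg_inv_pow_ne_zero hp le_rfl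
  have e : Finset.Icc 1 2 = {1, 2} := rfl
  simp only [bsym, e, Finset.Icc_self, Finset.prod_singleton, pow_one, Nat.add_one_sub_one,
    Finset.mem_singleton, OfNat.one_ne_ofNat, not_false_eq_true, Finset.prod_insert]
  rw [div_eq_iff (mul_ne_zero h1 h1)]
  ring

theorem localFactor_zero {p : ℕ} (hp : 1 < p) (L L' : ℕ) : localFactor p L L' 0 0 = 1 := by
  simp [localFactor, bsym_self hp]

theorem localFactor_one_one {p L L' : ℕ} (hp : 1 < p) (h : 1 ≤ L') :
    localFactor p L L' 1 1 = (-(p : ℚ)) ^ L' := by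
  simp [localFactor, min_eq_right h, bsym_self hp]

theorem localFactor_two_two {p : ℕ} (hp : 1 < p) :
    localFactor p 2 2 2 2 = (-(p : ℚ)) ^ 3 := by
  simp [localFactor, bsym_self hp]

theorem localFactor_one_zero {p L L' : ℕ} (h : L' ≤ L) (hL : L ≤ 2) (hL1 : 1 ≤ L) (hp : 1 < p) :
    localFactor p L L' 1 0 =
      if L' = 2 then (1 + (-(p : ℚ))⁻¹) * (1 + (-(p : ℚ)) ^ 2)
      else if L' = 1 then (if L = 2 then 1 + (-(p : ℚ))⁻¹ - p else 1 - p)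
      else (if L = 2 then 1 + (-(p : ℚ))⁻¹ else 1) := by
  have e : Finset.Icc 0 1 = {0, 1} := rfl
  interval_cases L <;> interval_cases L' <;>
    simp [localFactor, e, bsym_self hp, bsym_two_one hp, bsym_zero_right hp] <;> ring

theorem localFactor_two_one {p L' : ℕ} (hL' : L' ≤ 2) (h : 1 ≤ L') (hp : 1 < p) :
    localFactor p 2 L' 2 1 = if L' = 2 then (-(p : ℚ)) ^ 2 * (1 - p) else -(p : ℚ) := by
  have e : Finset.Icc 1 2 = {1, 2} := rfl
  interval_cases L' <;>
    simp [localFactor, e, bsym_self hp, bsym_zero_right hp]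
  ring

theorem localFactor_two_zero {p L' : ℕ} (hL' : L' ≤ 2) (hp : 1 < p) :
    localFactor p 2 L' 2 0 =
      if L' = 2 then (1 - (p : ℚ)) * (1 + p ^ 2) else if L' = 1 then 1 - (p : ℚ) else 1 := by
  have e : Finset.Icc 0 2 = {0, 1, 2} := rfl
  have e' : Finset.Icc 0 1 = {0, 1} := rfl
  have hp0 : (p : ℚ) ≠ 0 := by positivity
  interval_cases L' <;>
    simp [localFactor, e, e', bsym_self hp, bsym_zero_right hp, bsym_two_one hp] <;>
    field_simp <;> ring

theorem dualCt_le_two (a : ℕ × ℕ) (i : ℕ) : dualCt a i ≤ 2 := by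
  unfold dualCt; split_ifs <;> omega

theorem dualCt_eq_zero {a : ℕ × ℕ} {i : ℕ} (h1 : a.1 < i) (h2 : a.2 < i) : dualCt a i = 0 := by
  unfold dualCt; split_ifs <;> omega

theorem dualCt_eq_one {a : ℕ × ℕ} {i : ℕ} (h1 : i ≤ a.1) (h2 : a.2 < i) : dualCt a i = 1 := by
  unfold dualCt; split_ifs <;> omega

theorem dualCt_eq_two {a : ℕ × ℕ} {i : ℕ} (h1 : i ≤ a.1) (h2 : i ≤ a.2) : dualCt a i = 2 := by
  unfold dualCt; split_ifs <;> omega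

theorem prod_hirI_two_columns {p : ℕ} (hp : 1 < p) {a b c d : ℕ} (hba : b ≤ a)
    (hdc : d ≤ c) (hd : d ≤ b + 1) :
    ∏ j ∈ Finset.Ico 1 d, hirI p (c, d) (a, b) j = (-(p : ℚ)) ^ (3 * (d - 1)) := by
  rw [Finset.prod_congr rfl (g := fun _ ↦ (-(p : ℚ)) ^ 3)]
  · simp [pow_mul]
  · intro j hj
    rw [Finset.mem_Ico] at hj
    rw [hirI_eq_localFactor, dualCt_eq_two, dualCt_eq_two, dualCt_eq_two, dualCt_eq_two,
      localFactor_two_two hp] <;> dsimp only <;> omega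

theorem prod_hirI_one_column {p : ℕ} (hp : 1 < p) {a b c d n : ℕ} (hba : b ≤ a)
    (hc : c ≤ a + 1) (hdn : d + 1 ≤ n) (hnc : n ≤ c) :
    ∏ j ∈ Finset.Ico (d + 1) n, hirI p (c, d) (a, b) j =
      (-(p : ℚ)) ^ (n + min n (b + 1)) / (-(p : ℚ)) ^ (d + 1 + min (d + 1) (b + 1)) := by
  have hp0 : (-(p : ℚ)) ≠ 0 := neg_ne_zero.2 (by positivity)
  induction n, hdn using Nat.le_induction with
  | base => simp [hp0]
  | succ n hn ih =>
    rw [Finset.prod_Ico_succ_top hn, ih (by omega), hirI_eq_localFactor,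
      dualCt_eq_one (a := (c, d)) (i := n) (by dsimp only; omega) (by dsimp only; omega),
      dualCt_eq_one (a := (c, d)) (i := n + 1) (by dsimp only; omega) (by dsimp only; omega)]
    by_cases h : n + 1 ≤ b + 1
    · rw [dualCt_eq_two (a := (a + 1, b + 1)) (i := n + 1) (by dsimp only; omega) h,
        localFactor_one_one hp one_le_two, min_eq_left h,
        min_eq_left (show n ≤ b + 1 by omega)]
      field_simp
      ring
    · rw [dualCt_eq_one (a := (a + 1, b + 1)) (i := n + 1) (by dsimp only; omega)
        (by dsimp only; omega), localFactor_one_one hp le_rfl,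
        min_eq_right (show b + 1 ≤ n + 1 by omega), min_eq_right (show b + 1 ≤ n by omega)]
      field_simp
      ring

theorem prod_hirI_no_column {p : ℕ} (hp : 1 < p) {a b c d m n : ℕ} (hdc : d ≤ c) (hm : c < m) :
    ∏ j ∈ Finset.Ico m n, hirI p (c, d) (a, b) j = 1 := by
  refine Finset.prod_eq_one fun j hj ↦ ?_
  rw [Finset.mem_Ico] at hj
  rw [hirI_eq_localFactor, dualCt_eq_zero (a := (c, d)), dualCt_eq_zero (a := (c, d)),
    localFactor_zero hp] <;> dsimp only <;> omega

theorem Icc_one_eq_Ico (a : ℕ) : Finset.Icc 1 (a + 1) = Finset.Ico 1 (a + 2) := by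
  ext; simp; omega

/-- The value of `I_c((c,d),(a,b))` for `d < c`. -/
noncomputable def cornerFactor (p a b c : ℕ) : ℚ :=
  localFactor p (dualCt (a + 1, b + 1) c) (dualCt (a + 1, b + 1) (c + 1)) 1 0

theorem prod_hirI_zero {p : ℕ} (hp : 1 < p) (a b : ℕ) :
    ∏ j ∈ Finset.Icc 1 (a + 1), hirI p (0, 0) (a, b) j = 1 := by
  rw [Icc_one_eq_Ico, prod_hirI_no_column hp le_rfl one_pos]

theorem hirI_corner {p a b c d : ℕ} (hdc : d < c) :
    hirI p (c, d) (a, b) c = cornerFactor p a b c := by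
  rw [hirI_eq_localFactor, dualCt_eq_one (a := (c, d)) le_rfl hdc,
    dualCt_eq_zero (a := (c, d)) (i := c + 1) (by simp) (by dsimp only; omega)]
  rfl

theorem prod_hirI_row {p : ℕ} (hp : 1 < p) {a b c : ℕ} (hba : b ≤ a) (hc : c ≤ a + 1)
    (hc0 : 0 < c) :
    ∏ j ∈ Finset.Icc 1 (a + 1), hirI p (c, 0) (a, b) j =
      (-(p : ℚ)) ^ (c + min c (b + 1)) / (-(p : ℚ)) ^ 2 * cornerFactor p a b c := by
  rw [Icc_one_eq_Ico, ← Finset.prod_Ico_consecutive _ (show 1 ≤ c + 1 by omega)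
    (show c + 1 ≤ a + 2 by omega), prod_hirI_no_column hp (Nat.zero_le c) (Nat.lt_succ_self c),
    Finset.prod_Ico_succ_top hc0, hirI_corner hc0,
    prod_hirI_one_column hp hba hc hc0 le_rfl, min_eq_left (show 0 + 1 ≤ b + 1 by omega), mul_one]

theorem prod_hirI_of_lt {p : ℕ} (hp : 1 < p) {a b c d : ℕ} (hba : b ≤ a) (hc : c ≤ a + 1)
    (hdc : d < c) (hd1 : 1 ≤ d) (hd : d ≤ b + 1) :
    ∏ j ∈ Finset.Icc 1 (a + 1), hirI p (c, d) (a, b) j =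
      (-(p : ℚ)) ^ (3 * (d - 1)) * (if d ≤ b then (-(p : ℚ)) ^ 2 * (1 - p) else -(p : ℚ)) *
        ((-(p : ℚ)) ^ (c + min c (b + 1)) / (-(p : ℚ)) ^ (d + 1 + min (d + 1) (b + 1))) *
        cornerFactor p a b c := by
  have key : hirI p (c, d) (a, b) d =
      if d ≤ b then (-(p : ℚ)) ^ 2 * (1 - p) else -(p : ℚ) := by
    rw [hirI_eq_localFactor, dualCt_eq_two (a := (c, d)) hdc.le le_rfl,
      dualCt_eq_one (a := (c, d)) (i := d + 1) (by dsimp only; omega) (by simp),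
      dualCt_eq_two (a := (a + 1, b + 1)) (i := d) (by dsimp only; omega) hd]
    by_cases h : d ≤ b
    · rw [dualCt_eq_two (by dsimp only; omega) (by dsimp only; omega),
        localFactor_two_one le_rfl one_le_two hp, if_pos h, if_pos rfl]
    · rw [dualCt_eq_one (by dsimp only; omega) (by dsimp only; omega),
        localFactor_two_one one_le_two le_rfl hp, if_neg h, if_neg (by omega)]
  rw [Icc_one_eq_Ico, ← Finset.prod_Ico_consecutive _ (show 1 ≤ c + 1 by omega)
    (show c + 1 ≤ a + 2 by omega), prod_hirI_no_column hp hdc.le (Nat.lt_succ_self c),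
    Finset.prod_Ico_succ_top (by omega), hirI_corner hdc,
    ← Finset.prod_Ico_consecutive _ (show 1 ≤ d + 1 by omega) (show d + 1 ≤ c by omega),
    prod_hirI_one_column hp hba hc hdc le_rfl, Finset.prod_Ico_succ_top hd1,
    prod_hirI_two_columns hp hba hdc.le hd, key, mul_one]

theorem prod_hirI_diag {p : ℕ} (hp : 1 < p) {a b d : ℕ} (hba : b ≤ a)
    (hd1 : 1 ≤ d) (hd : d ≤ b + 1) :
    ∏ j ∈ Finset.Icc 1 (a + 1), hirI p (d, d) (a, b) j =
      (-(p : ℚ)) ^ (3 * (d - 1)) *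
        (if d ≤ b then (1 - (p : ℚ)) * (1 + p ^ 2) else if b < a then 1 - (p : ℚ) else 1) := by
  have key : hirI p (d, d) (a, b) d =
      if d ≤ b then (1 - (p : ℚ)) * (1 + p ^ 2) else if b < a then 1 - (p : ℚ) else 1 := by
    rw [hirI_eq_localFactor, dualCt_eq_two (a := (d, d)) le_rfl le_rfl,
      dualCt_eq_zero (a := (d, d)) (i := d + 1) (by simp) (by simp),
      dualCt_eq_two (a := (a + 1, b + 1)) (i := d) (by dsimp only; omega) hd,
      localFactor_two_zero (dualCt_le_two _ _) hp]
    unfold dualCt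
    dsimp only
    split_ifs <;> first | rfl | omega
  rw [Icc_one_eq_Ico, ← Finset.prod_Ico_consecutive _ (show 1 ≤ d + 1 by omega)
    (show d + 1 ≤ a + 2 by omega), prod_hirI_no_column hp le_rfl (Nat.lt_succ_self d),
    Finset.prod_Ico_succ_top hd1, prod_hirI_two_columns hp hba le_rfl hd, key, mul_one]

theorem cornerFactor_of_le {p a b c : ℕ} (hp : 1 < p) (hba : b ≤ a) (hc : c ≤ b) :
    cornerFactor p a b c = (1 - (p : ℚ)⁻¹) * (1 + (p : ℚ) ^ 2) := by
  rw [cornerFactor, dualCt_eq_two, dualCt_eq_two, localFactor_one_zero le_rfl le_rfl one_le_two hp,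
    if_pos rfl, inv_neg, neg_sq, sub_eq_add_neg] <;> dsimp only <;> omega

theorem cornerFactor_add_one {p a b : ℕ} (hp : 1 < p) (hba : b ≤ a) :
    cornerFactor p a b (b + 1) = 1 - (p : ℚ)⁻¹ - if b < a then (p : ℚ) else 0 := by
  rw [cornerFactor, dualCt_eq_two (i := b + 1) (by dsimp only; omega) (by simp)]
  split_ifs with h
  · rw [dualCt_eq_one (by dsimp only; omega) (by simp),
      localFactor_one_zero one_le_two le_rfl one_le_two hp]
    norm_num
    ring
  · rw [dualCt_eq_zero (by dsimp only; omega) (by simp),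
      localFactor_one_zero zero_le_two le_rfl one_le_two hp]
    norm_num
    ring

theorem cornerFactor_of_lt {p a b c : ℕ} (hp : 1 < p) (hbc : b + 1 < c) (hc : c ≤ a + 1) :
    cornerFactor p a b c = 1 - if c ≤ a then (p : ℚ) else 0 := by
  rw [cornerFactor, dualCt_eq_one (i := c) hc hbc]
  split_ifs with h
  · rw [dualCt_eq_one (by dsimp only; omega) (by dsimp only; omega),
      localFactor_one_zero le_rfl one_le_two le_rfl hp]
    norm_num
  · rw [dualCt_eq_zero (by dsimp only; omega) (by dsimp only; omega),
      localFactor_one_zero zero_le_one one_le_two le_rfl hp]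
    norm_num

/-- The summand of `Fp p a b X` at the pair `(c,d)`. -/
noncomputable def hirTerm (p a b : ℕ) (X : ℝ) (c d : ℕ) : ℝ :=
  (-1 : ℝ) ^ d * ((p : ℝ) ^ (2 * d + c))⁻¹ * X ^ (c + d) *
    (-(p : ℝ)) ^ (epsn c + epsn d) *
    ∏ j ∈ Finset.Icc 1 (a + 1), ((hirI p (c, d) (a, b) j : ℚ) : ℝ)

theorem hirTerm_zero_zero {p : ℕ} (hp : 1 < p) (a b : ℕ) (X : ℝ) : hirTerm p a b X 0 0 = 1 := by
  rw [hirTerm, ← Rat.cast_prod, prod_hirI_zero hp]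
  simp [epsn]

theorem hirTerm_row {p : ℕ} (hp : 1 < p) {a b c : ℕ} (hba : b ≤ a) (hc : c ≤ a + 1)
    (hc0 : 0 < c) (X : ℝ) :
    hirTerm p a b X c 0 =
      -(cornerFactor p a b c * (-(p : ℝ)) ^ (c + min c (b + 1)) * (X / p) ^ c / p) := by
  have hp0 : (p : ℝ) ≠ 0 := by positivity
  rw [hirTerm, ← Rat.cast_prod, prod_hirI_row hp hba hc hc0]
  push_cast
  simp only [epsn, hc0.ne', if_true, if_false, div_pow]
  generalize (-(p : ℝ)) ^ (c + min c (b + 1)) = Q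
  field_simp
  simp
  ring

theorem hirTerm_of_lt {p : ℕ} (hp : 1 < p) {a b c d : ℕ} (hba : b ≤ a) (hc : c ≤ a + 1)
    (hdc : d < c) (hd1 : 1 ≤ d) (hd : d ≤ b + 1) (X : ℝ) :
    hirTerm p a b X c d =
      -(cornerFactor p a b c * (-(p : ℝ)) ^ (c + min c (b + 1)) * (X / p) ^ c / p) *
        ((if d ≤ b then 1 - (p : ℝ) else 1) * (X / p) ^ d) := by
  have hp0 : (p : ℝ) ≠ 0 := by positivity
  obtain ⟨d, rfl⟩ : ∃ e, d = e + 1 := ⟨d - 1, by omega⟩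
  rw [hirTerm, ← Rat.cast_prod, prod_hirI_of_lt hp hba hc hdc hd1 hd]
  push_cast
  simp only [epsn, (show c ≠ 0 by omega), (show d + 1 ≠ 0 by omega), if_false, div_pow]
  generalize (-(p : ℝ)) ^ (c + min c (b + 1)) = Q
  rcases neg_one_pow_eq_or ℝ d with h | h <;> split_ifs with hb
  all_goals
    first
    | rw [min_eq_left (show d + 1 + 1 ≤ b + 1 by omega)]
    | rw [min_eq_right (show b + 1 ≤ d + 1 + 1 by omega), show b = d by omega]
    simp only [neg_pow (p : ℝ), pow_add, pow_mul', mul_add, h]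
    push_cast
    field_simp

theorem hirTerm_diag {p : ℕ} (hp : 1 < p) {a b d : ℕ} (hba : b ≤ a)
    (hd1 : 1 ≤ d) (hd : d ≤ b + 1) (X : ℝ) :
    hirTerm p a b X d d =
      -((if d ≤ b then (1 - (p : ℝ)) * (1 + p ^ 2) else if b < a then 1 - (p : ℝ) else 1) *
        X ^ (2 * d) / p) := by
  have hp0 : (p : ℝ) ≠ 0 := by positivity
  obtain ⟨d, rfl⟩ : ∃ e, d = e + 1 := ⟨d - 1, by omega⟩
  rw [hirTerm, ← Rat.cast_prod, prod_hirI_diag hp hba hd1 hd, Rat.cast_mul]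
  have hU : (((if d + 1 ≤ b then (1 - (p : ℚ)) * (1 + p ^ 2)
      else if b < a then 1 - (p : ℚ) else 1 : ℚ)) : ℝ) =
      if d + 1 ≤ b then (1 - (p : ℝ)) * (1 + p ^ 2) else if b < a then 1 - (p : ℝ) else 1 := by
    split_ifs <;> push_cast <;> rfl
  rw [hU]
  generalize (if d + 1 ≤ b then (1 - (p : ℝ)) * (1 + p ^ 2)
    else if b < a then 1 - (p : ℝ) else 1) = U
  simp only [epsn, (show d + 1 ≠ 0 by omega), if_false, Nat.add_sub_cancel]
  push_cast
  rcases neg_one_pow_eq_or ℝ d with h | h <;>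
  · simp only [neg_pow (p : ℝ), pow_add, pow_mul', mul_add, h]
    field_simp

theorem sum_hirTerm_row {p : ℕ} (hp : 1 < p) {a b c n : ℕ} (hba : b ≤ a) (hc : c ≤ a + 1)
    (hn : 1 ≤ n) (hnc : n ≤ c) (hnb : n ≤ b + 1) {X : ℝ} (hX : X ≠ p) :
    ∑ d ∈ Finset.range n, hirTerm p a b X c d =
      -(cornerFactor p a b c * (-(p : ℝ)) ^ (c + min c (b + 1)) * (X / p) ^ c / p) *
        (((1 - p) * (X / p) ^ n + X - 1) / (X / p - 1)) := by
  have hp0 : (p : ℝ) ≠ 0 := by positivity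
  have hx : X / p - 1 ≠ 0 := by rwa [sub_ne_zero, Ne, div_eq_one_iff_eq hp0]
  induction n, hn using Nat.le_induction with
  | base =>
    rw [Finset.sum_range_one, hirTerm_row hp hba hc hnc,
      show (1 - (p : ℝ)) * (X / p) ^ 1 + X - 1 = X / p - 1 by field_simp; ring,
      div_self hx, mul_one]
  | succ n hn ih =>
    rw [Finset.sum_range_succ, ih (by omega) (by omega),
      hirTerm_of_lt hp hba hc hnc hn (by omega), if_pos (by omega), ← mul_add]
    congr 1
    rw [div_add' _ _ _ hx]
    ring

theorem sum_hirTerm_of_le {p : ℕ} (hp : 1 < p) {a b c : ℕ} (hba : b ≤ a)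
    (hc : 1 ≤ c) (hcb : c ≤ b + 1) {X : ℝ} (hX : X ≠ p) :
    ∑ d ∈ Finset.range (min c (b + 1) + 1), hirTerm p a b X c d =
      -(cornerFactor p a b c * (p * X) ^ c / p) *
          (((1 - p) * (X / p) ^ c + X - 1) / (X / p - 1)) -
        (if c ≤ b then (1 - (p : ℝ)) * (1 + p ^ 2) else if b < a then 1 - (p : ℝ) else 1) *
          X ^ (2 * c) / p := by
  have hp0 : (p : ℝ) ≠ 0 := by positivity
  rw [min_eq_left hcb, Finset.sum_range_succ,
    sum_hirTerm_row hp hba (by omega) hc le_rfl hcb hX, min_eq_left hcb,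
    hirTerm_diag hp hba hc hcb, ← sub_eq_add_neg, mul_assoc (cornerFactor p a b c : ℝ),
    ← two_mul, pow_mul, neg_sq, ← mul_pow, show (p : ℝ) ^ 2 * (X / p) = p * X by field_simp]

theorem sum_hirTerm_of_gt {p : ℕ} (hp : 1 < p) {a b i : ℕ}
    (hc : b + 1 + (i + 1) ≤ a + 1) {X : ℝ} (hX : X ≠ p) :
    ∑ d ∈ Finset.range (min (b + 1 + (i + 1)) (b + 1) + 1),
        hirTerm p a b X (b + 1 + (i + 1)) d =
      -(cornerFactor p a b (b + 1 + (i + 1)) * ((p * X) ^ (b + 1) * (-X) ^ (i + 1)) / p) *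
          (((1 - p) * (X / p) ^ (b + 1) + X - 1) / (X / p - 1) + (X / p) ^ (b + 1)) := by
  have hp0 : (p : ℝ) ≠ 0 := by positivity
  have hmin : min (b + 1 + (i + 1)) (b + 1) = b + 1 := by omega
  have key : (-(p : ℝ)) ^ (b + 1 + (i + 1) + (b + 1)) * (X / p) ^ (b + 1 + (i + 1)) =
      (p * X) ^ (b + 1) * (-X) ^ (i + 1) := by
    rw [show b + 1 + (i + 1) + (b + 1) = 2 * (b + 1) + (i + 1) by ring, pow_add, pow_mul,
      pow_add (X / p), mul_mul_mul_comm, ← mul_pow, ← mul_pow]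
    congr 2 <;> field_simp
  rw [hmin, Finset.sum_range_succ, sum_hirTerm_row hp (by omega) hc (by omega) (by omega) le_rfl hX,
    hirTerm_of_lt hp (by omega) hc (by omega) (by omega) le_rfl, if_neg (by omega), one_mul,
    ← mul_add, hmin, mul_assoc (cornerFactor p a b _ : ℝ), key]

theorem Fp_eq_sum_rows {p : ℕ} (hp : 1 < p) (b n : ℕ) (X : ℝ) :
    Fp p (b + n) b X = 1 +
      ∑ i ∈ Finset.range b, ∑ d ∈ Finset.range (min (i + 1) (b + 1) + 1),
        hirTerm p (b + n) b X (i + 1) d +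
      ∑ d ∈ Finset.range (min (b + 1) (b + 1) + 1), hirTerm p (b + n) b X (b + 1) d +
      ∑ i ∈ Finset.range n, ∑ d ∈ Finset.range (min (b + 1 + (i + 1)) (b + 1) + 1),
        hirTerm p (b + n) b X (b + 1 + (i + 1)) d := by
  have h : Fp p (b + n) b X = ∑ c ∈ Finset.range (1 + b + 1 + n),
      ∑ d ∈ Finset.range (min c (b + 1) + 1), hirTerm p (b + n) b X c d := by
    rw [show 1 + b + 1 + n = b + n + 2 by ring]
    rfl
  rw [h, Finset.sum_range_add, Finset.sum_range_succ, Finset.sum_range_add, Finset.sum_range_one]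
  simp only [Nat.zero_min, zero_add, Finset.sum_range_one, hirTerm_zero_zero hp, add_comm 1]
  congr 1
  refine Finset.sum_congr rfl fun i _ ↦ ?_
  rw [show b + 1 + 1 + i = b + 1 + (i + 1) by ring]

theorem sum_rows_le {p : ℕ} (hp : 1 < p) {a b : ℕ} (hba : b ≤ a) {X : ℝ} (hX : X ≠ p)
    (hX2 : X ^ 2 ≠ 1) (hpX : (p : ℝ) * X ≠ 1) :
    ∑ i ∈ Finset.range b, ∑ d ∈ Finset.range (min (i + 1) (b + 1) + 1),
        hirTerm p a b X (i + 1) d =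
      -((1 - (p : ℝ)⁻¹) * (1 + p ^ 2)) * X / (X / p - 1) *
        ((1 - p) * X / p * (((X ^ 2) ^ b - 1) / (X ^ 2 - 1)) +
          (X - 1) * (((p * X) ^ b - 1) / (p * X - 1))) -
      (1 - (p : ℝ)) * (1 + p ^ 2) * X ^ 2 / p * (((X ^ 2) ^ b - 1) / (X ^ 2 - 1)) := by
  have hp0 : (p : ℝ) ≠ 0 := by positivity
  rw [← geom_sum_eq hX2, ← geom_sum_eq hpX, Finset.mul_sum, Finset.mul_sum,
    ← Finset.sum_add_distrib, Finset.mul_sum, Finset.mul_sum, ← Finset.sum_sub_distrib]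
  refine Finset.sum_congr rfl fun i hi ↦ ?_
  rw [Finset.mem_range] at hi
  rw [sum_hirTerm_of_le hp hba (by omega) (by omega) hX, if_pos (by omega),
    cornerFactor_of_le hp hba (by omega)]
  have hx : X / p - 1 ≠ 0 := by rwa [sub_ne_zero, Ne, div_eq_one_iff_eq hp0]
  push_cast
  generalize hD : X / p - 1 = D at *
  simp only [div_pow, mul_pow]
  field_simp
  ring

theorem sum_rows_gt {p : ℕ} (hp : 1 < p) {b k : ℕ} {X : ℝ} (hX : X ≠ p) (hX1 : X ≠ -1) :
    ∑ i ∈ Finset.range (2 * k + 2), ∑ d ∈ Finset.range (min (b + 1 + (i + 1)) (b + 1) + 1),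
        hirTerm p (b + (2 * k + 2)) b X (b + 1 + (i + 1)) d =
      -((p * X) ^ (b + 1) / p) *
        ((1 - p) * (X * (X ^ (2 * k + 1) + 1) / (- X - 1)) + X ^ (2 * k + 2)) *
          (((1 - p) * (X / p) ^ (b + 1) + X - 1) / (X / p - 1) + (X / p) ^ (b + 1)) := by
  have hX1' : -X ≠ 1 := fun h ↦ hX1 (by linarith)
  have hgeom : ∑ i ∈ Finset.range (2 * k + 1), (-X) ^ (i + 1) =
      X * (X ^ (2 * k + 1) + 1) / (-X - 1) := by
    simp only [pow_succ']
    rw [← Finset.mul_sum, geom_sum_eq hX1', Odd.neg_pow ⟨k, rfl⟩]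
    ring
  rw [Finset.sum_range_succ, sum_hirTerm_of_gt hp (by omega) hX,
    cornerFactor_of_lt hp (by omega) (by omega), if_neg (by omega),
    Even.neg_pow (n := 2 * k + 1 + 1) ⟨k + 1, by ring⟩, ← hgeom]
  have hrow : ∀ i ∈ Finset.range (2 * k + 1),
      ∑ d ∈ Finset.range (min (b + 1 + (i + 1)) (b + 1) + 1),
        hirTerm p (b + (2 * k + 2)) b X (b + 1 + (i + 1)) d =
      -((p * X) ^ (b + 1) / p) * (1 - p) *
        (((1 - p) * (X / p) ^ (b + 1) + X - 1) / (X / p - 1) + (X / p) ^ (b + 1)) *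
          (-X) ^ (i + 1) := by
    intro i hi
    rw [Finset.mem_range] at hi
    rw [sum_hirTerm_of_gt hp (by omega) hX,
      cornerFactor_of_lt hp (by omega) (by omega), if_pos (by omega)]
    push_cast
    ring
  rw [Finset.sum_congr rfl hrow, ← Finset.mul_sum]
  push_cast
  ring

theorem statement16 (p : ℕ) (hp : p.Prime) (hodd : Odd p)
    (a b : ℕ) (hba : b ≤ a) (hev : Even (a + b))
    (ε : ℕ) (hε : ε = if Even b then 0 else 1)
    (X : ℝ) (hXp : X ≠ (p : ℝ)) (hX1 : X ≠ 1) (hX2 : X ≠ -1) (hpX : (p : ℝ) * X ≠ 1) :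
    Fp p a b X
      = ((1 - X) * (X + p) / p) * (X ^ 2 - ((p : ℝ) ^ 2 - p) * X + 1) ^ ε
        + ((X - 1) * (X + p) / (X - p)) *
          ((p : ℝ) * X * (1 - p) *
              ((((p : ℝ) * X) ^ b - ((p : ℝ) * X) ^ ε) / ((p : ℝ) * X - 1))
            + X ^ 2 * ((p : ℝ) - (p : ℝ)⁻¹ * X) *
              ((X ^ (2 * b) - X ^ (2 * ε)) / (X ^ 2 - 1))
            + (-(p : ℝ) ^ (b + 1) * (X - 1) + (p : ℝ) * X ^ (b + 1)
                - (p : ℝ)⁻¹ * X ^ (b + 2)) *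
              ((X ^ (a + 1) - X ^ (b + 1)) / (X ^ 2 - 1))) := by
  have hp1 : 1 < p := hp.one_lt
  have hp0 : (p : ℝ) ≠ 0 := by exact_mod_cast hp.ne_zero
  have hXp' : X - p ≠ 0 := sub_ne_zero.2 hXp
  have hpX' : (p : ℝ) * X - 1 ≠ 0 := sub_ne_zero.2 hpX
  have hXX : X ^ 2 - 1 = (X - 1) * (X + 1) := by ring
  have hX1' : X - 1 ≠ 0 := sub_ne_zero.2 hX1
  have hX2' : X + 1 ≠ 0 := fun h ↦ hX2 (by linarith)
  have hsq : X ^ 2 ≠ 1 := sub_ne_zero.1 (hXX ▸ mul_ne_zero hX1' hX2')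
  have hx : X / p - 1 = (X - p) / p := by field_simp
  have hneg : -X - 1 = -(X + 1) := by ring
  obtain ⟨m, rfl⟩ : ∃ m, a = b + 2 * m := by
    obtain ⟨k, hk⟩ := hev
    exact ⟨k - b, by omega⟩
  have hε' : ε = 0 ∨ ε = 1 := by split_ifs at hε <;> simp [hε]
  clear hε
  rw [Fp_eq_sum_rows hp1, sum_rows_le hp1 hba hXp hsq hpX,
    sum_hirTerm_of_le hp1 hba (by omega) le_rfl hXp, if_neg (show ¬ b + 1 ≤ b by omega),
    cornerFactor_add_one hp1 hba]
  rcases m with _ | k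
  · simp only [mul_zero, add_zero, lt_irrefl, if_false, Finset.range_zero, Finset.sum_empty]
    push_cast
    rw [hx, hXX]
    simp only [div_pow, mul_pow, pow_succ, pow_mul']
    rcases hε' with rfl | rfl
    · field_simp
      ring
    · field_simp
      ring
  · rw [if_pos (by omega), if_pos (by omega), show 2 * (k + 1) = 2 * k + 2 by ring,
      sum_rows_gt hp1 hXp hX2, hx, hXX, hneg]
    push_cast
    simp only [div_pow, mul_pow, pow_succ, pow_mul', pow_add]
    rcases hε' with rfl | rfl
    · field_simp
      ring
    · field_simp
      ring
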